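/- Let G=(V,E)∈F(Δ), let X⊆V, and let Π be a graph problem with solutions S:V→{0,1} such that every S∈Π(G) takes both values on X (there are u,v∈X with S(u)=1 and S(v)=0). Then: (a) if there is a port numbering p of G such that all nodes in X are pairwise bisimilar in K_{+,+}(G,p), then Π∉VV; (b) if there is a port numbering p of G such that all nodes in X are pairwise bisimilar in K_{+,−}(G,p), then Π∉VB; (c) if there is a port numbering p of G such that all nodes in X are pairwise bisimilar in K_{−,−}(G,p), then Π∉SB. -/

import Mathlib

namespace Weak

/-- The degree of a vertex. -/
noncomputable def deg {n : ℕ} (G : SimpleGraph (Fin n)) (v : Fin n) : ℕ :=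
  Nat.card {u : Fin n // G.Adj v u}

/-- A port of a graph: a pair (v, i) with i ∈ [deg v]. -/
abbrev Port {n : ℕ} (G : SimpleGraph (Fin n)) : Type := Σ v : Fin n, Fin (deg G v)

/-- A port numbering: a bijection on ports with A(p) = A(G). -/
structure PortNumbering {n : ℕ} (G : SimpleGraph (Fin n)) where
  p : Port G ≃ Port G
  adj : ∀ u v : Fin n, (∃ i : Fin (deg G u), (p ⟨u, i⟩).1 = v) ↔ G.Adj u v

/-- A consistent port numbering is an involution. -/
def PortNumbering.Consistent {n : ℕ} {G : SimpleGraph (Fin n)} (pn : PortNumbering G) : Prop :=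
  ∀ q : Port G, pn.p (pn.p q) = q

/-- A distributed state machine for F(Δ), with stopping states Y. -/
structure DSM (Y : Type) (Δ : ℕ) where
  Z : Type
  z₀ : Fin (Δ + 1) → Y ⊕ Z
  M : Type
  m₀ : M
  μ : Z → Fin Δ → M
  δ : Z → (Fin Δ → M) → Y ⊕ Z

namespace DSM

variable {Y : Type} {Δ : ℕ}

/-- μ extended to stopping states: a stopped node sends the dummy message. -/
def μ' (A : DSM Y Δ) : Y ⊕ A.Z → Fin Δ → A.M
  | Sum.inl _ => fun _ => A.m₀
  | Sum.inr z => A.μ z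

/-- δ extended to stopping states: a stopped node no longer changes state. -/
def δ' (A : DSM Y Δ) : Y ⊕ A.Z → (Fin Δ → A.M) → Y ⊕ A.Z
  | Sum.inl y, _ => Sum.inl y
  | Sum.inr z, m => A.δ z m

/-- Machines whose transition depends only on the multiset of received messages. -/
def InMultiset (A : DSM Y Δ) : Prop :=
  ∀ (z : A.Z) (a b : Fin Δ → A.M),
    (List.ofFn a : Multiset A.M) = (List.ofFn b : Multiset A.M) → A.δ z a = A.δ z b

/-- Machines whose transition depends only on the set of received messages. -/
def InSet (A : DSM Y Δ) : Prop :=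
  ∀ (z : A.Z) (a b : Fin Δ → A.M), Set.range a = Set.range b → A.δ z a = A.δ z b

/-- Machines that send the same message to all ports. -/
def InBroadcast (A : DSM Y Δ) : Prop :=
  ∀ (z : A.Z) (i j : Fin Δ), A.μ z i = A.μ z j

end DSM

/-- The execution of a machine in (G, p): the state of node u at time t. -/
noncomputable def exec {Y : Type} {Δ n : ℕ} (A : DSM Y Δ) (G : SimpleGraph (Fin n))
    (hG : ∀ v, deg G v ≤ Δ) (pn : PortNumbering G) : ℕ → Fin n → Y ⊕ A.Z
  | 0, u => A.z₀ ⟨deg G u, Nat.lt_succ_of_le (hG u)⟩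
  | t + 1, u =>
      A.δ' (exec A G hG pn t u) fun k =>
        if h : (k : ℕ) < deg G u then
          A.μ' (exec A G hG pn t (pn.p.symm ⟨u, ⟨(k : ℕ), h⟩⟩).1)
            ⟨((pn.p.symm ⟨u, ⟨(k : ℕ), h⟩⟩).2 : ℕ),
              lt_of_lt_of_le (pn.p.symm ⟨u, ⟨(k : ℕ), h⟩⟩).2.isLt (hG _)⟩
        else A.m₀

/-- A graph problem: for each graph, a set of admissible outputs. -/
abbrev GraphProblem (Y : Type) : Type :=
  ∀ n : ℕ, SimpleGraph (Fin n) → Set ((Fin n) → Y)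

/-- A sequence of machines solves a problem in time T. -/
def SolvesInTime {Y : Type} (A : ∀ Δ : ℕ, DSM Y Δ) (P : GraphProblem Y)
    (T : ℕ → ℕ → ℕ) : Prop :=
  ∀ (Δ n : ℕ) (G : SimpleGraph (Fin n)) (hG : ∀ v, deg G v ≤ Δ) (pn : PortNumbering G),
    ∃ S ∈ P n G, ∀ u, exec (A Δ) G hG pn (T Δ n) u = Sum.inl (S u)

/-- A sequence of machines solves a problem in time T assuming consistency. -/
def SolvesInTimeConsistent {Y : Type} (A : ∀ Δ : ℕ, DSM Y Δ) (P : GraphProblem Y)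
    (T : ℕ → ℕ → ℕ) : Prop :=
  ∀ (Δ n : ℕ) (G : SimpleGraph (Fin n)) (hG : ∀ v, deg G v ≤ Δ) (pn : PortNumbering G),
    pn.Consistent →
    ∃ S ∈ P n G, ∀ u, exec (A Δ) G hG pn (T Δ n) u = Sum.inl (S u)

/-- Problem class VV. -/
def VV {Y : Type} (P : GraphProblem Y) : Prop :=
  ∃ A : ∀ Δ : ℕ, DSM Y Δ, ∃ T, SolvesInTime A P T

/-- Problem class MV. -/
def MV {Y : Type} (P : GraphProblem Y) : Prop :=
  ∃ A : ∀ Δ : ℕ, DSM Y Δ, (∀ Δ, (A Δ).InMultiset) ∧ ∃ T, SolvesInTime A P T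

/-- Problem class SV. -/
def SV {Y : Type} (P : GraphProblem Y) : Prop :=
  ∃ A : ∀ Δ : ℕ, DSM Y Δ, (∀ Δ, (A Δ).InSet) ∧ ∃ T, SolvesInTime A P T

/-- Problem class VB. -/
def VB {Y : Type} (P : GraphProblem Y) : Prop :=
  ∃ A : ∀ Δ : ℕ, DSM Y Δ, (∀ Δ, (A Δ).InBroadcast) ∧ ∃ T, SolvesInTime A P T

/-- Problem class MB. -/
def MB {Y : Type} (P : GraphProblem Y) : Prop :=
  ∃ A : ∀ Δ : ℕ, DSM Y Δ, (∀ Δ, (A Δ).InMultiset ∧ (A Δ).InBroadcast) ∧ ∃ T, SolvesInTime A P T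

/-- Problem class SB. -/
def SB {Y : Type} (P : GraphProblem Y) : Prop :=
  ∃ A : ∀ Δ : ℕ, DSM Y Δ, (∀ Δ, (A Δ).InSet ∧ (A Δ).InBroadcast) ∧ ∃ T, SolvesInTime A P T

/-- Problem class VVc. -/
def VVc {Y : Type} (P : GraphProblem Y) : Prop :=
  ∃ A : ∀ Δ : ℕ, DSM Y Δ, ∃ T, SolvesInTimeConsistent A P T

/-- Constant-time problem class VV(1). -/
def VV1 {Y : Type} (P : GraphProblem Y) : Prop :=
  ∃ A : ∀ Δ : ℕ, DSM Y Δ, ∃ T' : ℕ → ℕ, SolvesInTime A P fun Δ _ => T' Δ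

/-- Constant-time problem class MV(1). -/
def MV1 {Y : Type} (P : GraphProblem Y) : Prop :=
  ∃ A : ∀ Δ : ℕ, DSM Y Δ, (∀ Δ, (A Δ).InMultiset) ∧
    ∃ T' : ℕ → ℕ, SolvesInTime A P fun Δ _ => T' Δ

/-- Constant-time problem class SV(1). -/
def SV1 {Y : Type} (P : GraphProblem Y) : Prop :=
  ∃ A : ∀ Δ : ℕ, DSM Y Δ, (∀ Δ, (A Δ).InSet) ∧
    ∃ T' : ℕ → ℕ, SolvesInTime A P fun Δ _ => T' Δ

/-- Constant-time problem class VB(1). -/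
def VB1 {Y : Type} (P : GraphProblem Y) : Prop :=
  ∃ A : ∀ Δ : ℕ, DSM Y Δ, (∀ Δ, (A Δ).InBroadcast) ∧
    ∃ T' : ℕ → ℕ, SolvesInTime A P fun Δ _ => T' Δ

/-- Constant-time problem class MB(1). -/
def MB1 {Y : Type} (P : GraphProblem Y) : Prop :=
  ∃ A : ∀ Δ : ℕ, DSM Y Δ, (∀ Δ, (A Δ).InMultiset ∧ (A Δ).InBroadcast) ∧
    ∃ T' : ℕ → ℕ, SolvesInTime A P fun Δ _ => T' Δ

/-- Constant-time problem class SB(1). -/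
def SB1 {Y : Type} (P : GraphProblem Y) : Prop :=
  ∃ A : ∀ Δ : ℕ, DSM Y Δ, (∀ Δ, (A Δ).InSet ∧ (A Δ).InBroadcast) ∧
    ∃ T' : ℕ → ℕ, SolvesInTime A P fun Δ _ => T' Δ

/-- Constant-time problem class VVc(1). -/
def VVc1 {Y : Type} (P : GraphProblem Y) : Prop :=
  ∃ A : ∀ Δ : ℕ, DSM Y Δ, ∃ T' : ℕ → ℕ, SolvesInTimeConsistent A P fun Δ _ => T' Δ

end Weak
namespace Weak

/-- A Kripke model with accessibility relations indexed by I and propositions Φ. -/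
structure KripkeModel (I : Type) (Φ : Type) where
  W : Type
  R : I → W → W → Prop
  val : Φ → W → Prop

/-- Bisimulation between two Kripke models. -/
def IsBisimulation {I Φ : Type} (K K' : KripkeModel I Φ) (Z : K.W → K'.W → Prop) : Prop :=
  (∃ v v', Z v v') ∧
  (∀ v v', Z v v' → ∀ q, (K.val q v ↔ K'.val q v')) ∧
  (∀ (α : I) (v w) (v'), Z v v' → K.R α v w → ∃ w', K'.R α v' w' ∧ Z w w') ∧
  (∀ (α : I) (v v' w'), Z v v' → K'.R α v' w' → ∃ w, K.R α v w ∧ Z w w')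

/-- Two states are bisimilar if some bisimulation relates them. -/
def Bisimilar {I Φ : Type} (K K' : KripkeModel I Φ) (v : K.W) (v' : K'.W) : Prop :=
  ∃ Z, IsBisimulation K K' Z ∧ Z v v'

/-- The Kripke model K_{+,+}(G,p): relations R_{(i,j)}, valuation by degree. -/
def KPP {n : ℕ} (Δ : ℕ) (G : SimpleGraph (Fin n)) (pn : PortNumbering G) :
    KripkeModel (Fin Δ × Fin Δ) (Fin Δ) where
  W := Fin n
  R := fun α u v => ∃ hj : (α.2 : ℕ) < deg G v,
        (pn.p ⟨v, ⟨(α.2 : ℕ), hj⟩⟩).1 = u ∧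
        ((pn.p ⟨v, ⟨(α.2 : ℕ), hj⟩⟩).2 : ℕ) = (α.1 : ℕ)
  val := fun q v => deg G v = (q : ℕ) + 1

/-- The Kripke model K_{−,+}(G,p): relations R_{(*,j)}. -/
def KMP {n : ℕ} (Δ : ℕ) (G : SimpleGraph (Fin n)) (pn : PortNumbering G) :
    KripkeModel (Fin Δ) (Fin Δ) where
  W := Fin n
  R := fun j u v => ∃ hj : (j : ℕ) < deg G v, (pn.p ⟨v, ⟨(j : ℕ), hj⟩⟩).1 = u
  val := fun q v => deg G v = (q : ℕ) + 1

/-- The Kripke model K_{+,−}(G,p): relations R_{(i,*)}. -/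
def KPM {n : ℕ} (Δ : ℕ) (G : SimpleGraph (Fin n)) (pn : PortNumbering G) :
    KripkeModel (Fin Δ) (Fin Δ) where
  W := Fin n
  R := fun i u v => ∃ j : Fin (deg G v),
        (pn.p ⟨v, j⟩).1 = u ∧ ((pn.p ⟨v, j⟩).2 : ℕ) = (i : ℕ)
  val := fun q v => deg G v = (q : ℕ) + 1

/-- The Kripke model K_{−,−}(G,p): the single relation R_{(*,*)}. -/
def KMM {n : ℕ} (Δ : ℕ) (G : SimpleGraph (Fin n)) (pn : PortNumbering G) :
    KripkeModel Unit (Fin Δ) where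
  W := Fin n
  R := fun _ u v => ∃ j : Fin (deg G v), (pn.p ⟨v, j⟩).1 = u
  val := fun q v => deg G v = (q : ℕ) + 1

/-- Formulas of multimodal logic MML(I,Φ); with I = Unit this is basic modal logic ML(Φ). -/
inductive MFormula (I : Type) (Φ : Type) : Type
  | prop : Φ → MFormula I Φ
  | and : MFormula I Φ → MFormula I Φ → MFormula I Φ
  | not : MFormula I Φ → MFormula I Φ
  | dia : I → MFormula I Φ → MFormula I Φ

/-- Truth of an MML formula at a state of a Kripke model. -/
def MSat {I Φ : Type} (K : KripkeModel I Φ) : MFormula I Φ → K.W → Prop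
  | MFormula.prop q, v => K.val q v
  | MFormula.and φ ψ, v => MSat K φ v ∧ MSat K ψ v
  | MFormula.not φ, v => ¬ MSat K φ v
  | MFormula.dia α φ, v => ∃ w, K.R α v w ∧ MSat K φ w

/-- Formulas of graded multimodal logic GMML(I,Φ); with I = Unit this is GML(Φ). -/
inductive GFormula (I : Type) (Φ : Type) : Type
  | prop : Φ → GFormula I Φ
  | and : GFormula I Φ → GFormula I Φ → GFormula I Φ
  | not : GFormula I Φ → GFormula I Φ
  | dia : I → GFormula I Φ → GFormula I Φ
  | gdia : I → ℕ → GFormula I Φ → GFormula I Φ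

/-- Truth of a GMML formula at a state of a Kripke model. -/
def GSat {I Φ : Type} (K : KripkeModel I Φ) : GFormula I Φ → K.W → Prop
  | GFormula.prop q, v => K.val q v
  | GFormula.and φ ψ, v => GSat K φ v ∧ GSat K ψ v
  | GFormula.not φ, v => ¬ GSat K φ v
  | GFormula.dia α φ, v => ∃ w, K.R α v w ∧ GSat K φ w
  | GFormula.gdia α k φ, v => k ≤ Nat.card {w : K.W // K.R α v w ∧ GSat K φ w}

end Weak
namespace Weak
/-- The vector of messages received by node `u` in round `t + 1`. -/
noncomputable def inbox {Y : Type} {Δ n : ℕ} (A : DSM Y Δ) (G : SimpleGraph (Fin n))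
    (hG : ∀ v, deg G v ≤ Δ) (pn : PortNumbering G) (t : ℕ) (u : Fin n) : Fin Δ → A.M :=
  fun k =>
    if h : (k : ℕ) < deg G u then
      A.μ' (exec A G hG pn t (pn.p.symm ⟨u, ⟨(k : ℕ), h⟩⟩).1)
        ⟨((pn.p.symm ⟨u, ⟨(k : ℕ), h⟩⟩).2 : ℕ),
          lt_of_lt_of_le (pn.p.symm ⟨u, ⟨(k : ℕ), h⟩⟩).2.isLt (hG _)⟩
    else A.m₀

theorem DSM.InBroadcast.μ'_eq {Y : Type} {Δ : ℕ} {A : DSM Y Δ} (hA : A.InBroadcast)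
    (x : Y ⊕ A.Z) (i j : Fin Δ) : A.μ' x i = A.μ' x j := by
  cases x with
  | inl y => rfl
  | inr z => exact hA z i j

section Execution

variable {Y : Type} {Δ n : ℕ} (A : DSM Y Δ) (G : SimpleGraph (Fin n))
  (hG : ∀ v, deg G v ≤ Δ) (pn : PortNumbering G)

theorem exec_succ (t : ℕ) (u : Fin n) :
    exec A G hG pn (t + 1) u = A.δ' (exec A G hG pn t u) (inbox A G hG pn t u) := rfl

theorem inbox_of_le (t : ℕ) (u : Fin n) (k : Fin Δ) (h : deg G u ≤ k) :
    inbox A G hG pn t u k = A.m₀ := dif_neg h.not_gt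

theorem inbox_of_port (t : ℕ) (w : Fin n) (j : Fin (deg G w)) (k : Fin Δ)
    (hk : ((pn.p ⟨w, j⟩).2 : ℕ) = k) :
    inbox A G hG pn t (pn.p ⟨w, j⟩).1 k =
      A.μ' (exec A G hG pn t w) ⟨j, j.isLt.trans_le (hG w)⟩ := by
  obtain ⟨k, hkΔ⟩ := k
  obtain rfl : ((pn.p ⟨w, j⟩).2 : ℕ) = k := hk
  have key : ∀ q : Port G, q = ⟨w, j⟩ →
      A.μ' (exec A G hG pn t q.1) ⟨q.2, q.2.isLt.trans_le (hG _)⟩ =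
        A.μ' (exec A G hG pn t w) ⟨j, j.isLt.trans_le (hG w)⟩ := by
    rintro q rfl
    rfl
  rw [inbox, dif_pos (pn.p ⟨w, j⟩).2.isLt]
  exact key _ (pn.p.symm_apply_apply _)

theorem exists_port (u : Fin n) (k : ℕ) (h : k < deg G u) :
    ∃ (w : Fin n) (j : Fin (deg G w)),
      (pn.p ⟨w, j⟩).1 = u ∧ ((pn.p ⟨w, j⟩).2 : ℕ) = k := by
  have hp := pn.p.apply_symm_apply ⟨u, k, h⟩
  exact ⟨(pn.p.symm ⟨u, k, h⟩).1, (pn.p.symm ⟨u, k, h⟩).2, congrArg Sigma.fst hp,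
    congrArg (fun q : Port G => (q.2 : ℕ)) hp⟩

variable {A G hG pn}

/-- A degree-preserving relation along which equal states yield equivalent inboxes preserves
states throughout the execution. -/
theorem exec_eq_of_rel {Z : Fin n → Fin n → Prop}
    (hdeg : ∀ u v, Z u v → deg G u = deg G v)
    (hstep : ∀ t, (∀ u v, Z u v → exec A G hG pn t u = exec A G hG pn t v) →
      ∀ u v, Z u v → ∀ z, A.δ z (inbox A G hG pn t u) = A.δ z (inbox A G hG pn t v))
    (t : ℕ) : ∀ u v, Z u v → exec A G hG pn t u = exec A G hG pn t v := by
  induction t with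
  | zero =>
    intro u v h
    simp only [exec, hdeg u v h]
  | succ t ih =>
    intro u v h
    rw [exec_succ, exec_succ, ih u v h]
    cases exec A G hG pn t v with
    | inl y => rfl
    | inr z => exact hstep t ih u v h z

/-- Nodes on which the degree propositions `q₁, …, q_Δ` agree have equal degrees. -/
theorem deg_eq_of_val_iff (hG : ∀ v, deg G v ≤ Δ) {u v : Fin n}
    (h : ∀ q : Fin Δ, deg G u = (q : ℕ) + 1 ↔ deg G v = (q : ℕ) + 1) :
    deg G u = deg G v := by
  have key : ∀ a b : ℕ, a ≤ Δ → b ≤ Δ →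
      (∀ q : Fin Δ, a = (q : ℕ) + 1 ↔ b = (q : ℕ) + 1) → a = b := by
    intro a b ha hb hab
    rcases a with _ | a
    · rcases b with _ | b
      · rfl
      · exact (hab ⟨b, hb⟩).2 rfl
    · exact ((hab ⟨a, ha⟩).1 rfl).symm
  exact key _ _ (hG u) (hG v) h

theorem exec_eq_of_bisimilar_KPP {u v : Fin n}
    (h : Bisimilar (KPP Δ G pn) (KPP Δ G pn) u v) (t : ℕ) :
    exec A G hG pn t u = exec A G hG pn t v := by
  obtain ⟨Z, ⟨-, hval, hforth, -⟩, huv⟩ := h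
  have hdeg : ∀ u v : Fin n, Z u v → deg G u = deg G v :=
    fun u v h => deg_eq_of_val_iff hG (hval u v h)
  refine exec_eq_of_rel hdeg (fun t ih u v h z => ?_) t u v huv
  congr 1
  funext k
  rcases lt_or_ge (k : ℕ) (deg G u) with hk | hk
  · obtain ⟨w, j, rfl, hj⟩ := exists_port G pn u k hk
    obtain ⟨w', ⟨hj', hv, hk'⟩, hw⟩ :=
      hforth (k, ⟨j, j.isLt.trans_le (hG w)⟩) _ w v h ⟨j.isLt, rfl, hj⟩
    subst hv
    rw [inbox_of_port A G hG pn t w j k hj, inbox_of_port A G hG pn t w' _ k hk', ih w w' hw]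
  · rw [inbox_of_le A G hG pn t u k hk, inbox_of_le A G hG pn t v k (hdeg u v h ▸ hk)]

theorem exec_eq_of_bisimilar_KPM (hA : A.InBroadcast) {u v : Fin n}
    (h : Bisimilar (KPM Δ G pn) (KPM Δ G pn) u v) (t : ℕ) :
    exec A G hG pn t u = exec A G hG pn t v := by
  obtain ⟨Z, ⟨-, hval, hforth, -⟩, huv⟩ := h
  have hdeg : ∀ u v : Fin n, Z u v → deg G u = deg G v :=
    fun u v h => deg_eq_of_val_iff hG (hval u v h)
  refine exec_eq_of_rel hdeg (fun t ih u v h z => ?_) t u v huv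
  congr 1
  funext k
  rcases lt_or_ge (k : ℕ) (deg G u) with hk | hk
  · obtain ⟨w, j, rfl, hj⟩ := exists_port G pn u k hk
    obtain ⟨w', ⟨j', hv, hk'⟩, hw⟩ := hforth k _ w v h ⟨j, rfl, hj⟩
    subst hv
    rw [inbox_of_port A G hG pn t w j k hj, inbox_of_port A G hG pn t w' _ k hk', ih w w' hw]
    exact hA.μ'_eq _ _ _
  · rw [inbox_of_le A G hG pn t u k hk, inbox_of_le A G hG pn t v k (hdeg u v h ▸ hk)]

/-- If every predecessor of `u` is matched by a predecessor of `v` in the same state, then under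
broadcasting every message received by `u` is also received by `v`. -/
theorem range_inbox_subset (hA : A.InBroadcast) (t : ℕ) {u v : Fin n}
    (hdeg : deg G u = deg G v)
    (h : ∀ w, (∃ j, (pn.p ⟨w, j⟩).1 = u) → ∃ w', (∃ j, (pn.p ⟨w', j⟩).1 = v) ∧
      exec A G hG pn t w = exec A G hG pn t w') :
    Set.range (inbox A G hG pn t u) ⊆ Set.range (inbox A G hG pn t v) := by
  rintro _ ⟨k, rfl⟩
  rcases lt_or_ge (k : ℕ) (deg G u) with hk | hk
  · obtain ⟨w, j, rfl, hj⟩ := exists_port G pn u k hk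
    obtain ⟨w', ⟨j', rfl⟩, hw⟩ := h w ⟨j, rfl⟩
    refine ⟨⟨(pn.p ⟨w', j'⟩).2, (pn.p ⟨w', j'⟩).2.isLt.trans_le (hG _)⟩, ?_⟩
    rw [inbox_of_port A G hG pn t w j k hj, inbox_of_port A G hG pn t w' j' _ rfl, hw]
    exact hA.μ'_eq _ _ _
  · exact ⟨k, by
      rw [inbox_of_le A G hG pn t u k hk, inbox_of_le A G hG pn t v k (hdeg ▸ hk)]⟩

theorem exec_eq_of_bisimilar_KMM (hS : A.InSet) (hB : A.InBroadcast) {u v : Fin n}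
    (h : Bisimilar (KMM Δ G pn) (KMM Δ G pn) u v) (t : ℕ) :
    exec A G hG pn t u = exec A G hG pn t v := by
  obtain ⟨Z, ⟨-, hval, hforth, hback⟩, huv⟩ := h
  have hdeg : ∀ u v : Fin n, Z u v → deg G u = deg G v :=
    fun u v h => deg_eq_of_val_iff hG (hval u v h)
  refine exec_eq_of_rel hdeg (fun t ih u v h z => hS z _ _ (Set.Subset.antisymm ?_ ?_)) t u v huv
  · refine range_inbox_subset hB t (hdeg u v h) fun w hw => ?_
    obtain ⟨w', hw', hZ⟩ := hforth () u w v h hw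
    exact ⟨w', hw', ih w w' hZ⟩
  · refine range_inbox_subset hB t (hdeg u v h).symm fun w hw => ?_
    obtain ⟨w', hw', hZ⟩ := hback () u v w h hw
    exact ⟨w', hw', (ih w' w hZ).symm⟩

end Execution

/-- A sequence of machines whose executions never separate the nodes of `X` cannot solve a
problem all of whose solutions take both values on `X`. -/
theorem not_solvesInTime_of_exec_eq {Δ n : ℕ} {G : SimpleGraph (Fin n)}
    (hG : ∀ v, deg G v ≤ Δ) {X : Set (Fin n)} {P : GraphProblem Bool}
    (hP : ∀ S ∈ P n G, (∃ u ∈ X, S u = true) ∧ (∃ v ∈ X, S v = false))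
    (pn : PortNumbering G) {A : ∀ Δ : ℕ, DSM Bool Δ} {T : ℕ → ℕ → ℕ}
    (h : ∀ u ∈ X, ∀ v ∈ X, ∀ t, exec (A Δ) G hG pn t u = exec (A Δ) G hG pn t v) :
    ¬ SolvesInTime A P T := by
  intro hA
  obtain ⟨S, hS, hout⟩ := hA Δ n G hG pn
  obtain ⟨⟨u, hu, hSu⟩, v, hv, hSv⟩ := hP S hS
  have huv := h u hu v hv (T Δ n)
  rw [hout, hout, hSu, hSv] at huv
  exact Bool.noConfusion (Sum.inl.inj huv)

/-- Corollary: bisimilarity of a set of nodes, on which every solution must take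
both values, rules out solvability in VV / VB / SB respectively. -/
theorem bisimulation_corollary {n : ℕ} (Δ : ℕ) (G : SimpleGraph (Fin n))
    (hG : ∀ v, deg G v ≤ Δ) (X : Set (Fin n)) (P : GraphProblem Bool)
    (hP : ∀ S ∈ P n G, (∃ u ∈ X, S u = true) ∧ (∃ v ∈ X, S v = false)) :
    ((∃ pn : PortNumbering G,
        ∀ u ∈ X, ∀ v ∈ X, Bisimilar (KPP Δ G pn) (KPP Δ G pn) u v) → ¬ VV P) ∧
    ((∃ pn : PortNumbering G,
        ∀ u ∈ X, ∀ v ∈ X, Bisimilar (KPM Δ G pn) (KPM Δ G pn) u v) → ¬ VB P) ∧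
    ((∃ pn : PortNumbering G,
        ∀ u ∈ X, ∀ v ∈ X, Bisimilar (KMM Δ G pn) (KMM Δ G pn) u v) → ¬ SB P) := by
  refine ⟨?_, ?_, ?_⟩
  · rintro ⟨pn, h⟩ ⟨A, T, hA⟩
    exact not_solvesInTime_of_exec_eq hG hP pn
      (fun u hu v hv t => exec_eq_of_bisimilar_KPP (h u hu v hv) t) hA
  · rintro ⟨pn, h⟩ ⟨A, hB, T, hA⟩
    exact not_solvesInTime_of_exec_eq hG hP pn
      (fun u hu v hv t => exec_eq_of_bisimilar_KPM (hB Δ) (h u hu v hv) t) hA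
  · rintro ⟨pn, h⟩ ⟨A, hSB, T, hA⟩
    exact not_solvesInTime_of_exec_eq hG hP pn
      (fun u hu v hv t => exec_eq_of_bisimilar_KMM (hSB Δ).1 (hSB Δ).2 (h u hu v hv) t) hA
end Weak
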